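/- arXiv:1506.08247 — 10 statements merged into one kernel-verified Lean document; each statement's English description precedes it below -/
import Mathlib

section
/- Let f, f_1, ..., f_m : ℝ^n → ℝ be convex functions, let Q ⊆ ℝ^n be a nonempty closed convex set with ‖x − y‖ ≤ R for all x, y ∈ Q (R > 0), let C = ∩_{j=1}^m {x : f_j(x) ≤ 0}, and let x* be an optimal solution of min{f(x) : x ∈ Q ∩ C}. Suppose f is Lipschitz with constant M₁ on the closed ball B(x*, R) and every subgradient of every f_j at every point of B(x*, R) has norm at most M₂. Set h_k = R/√(k + 0.5). Let {x_k}_{k≥0} ⊆ Q with x₀ ∈ Q be such that for every k ≥ 0 one of the following holds: (i) there exist subgradients ḡ_{j,k} ∈ ∂f_j(x_k) (j = 1, ..., m) such that, defining H_{j,k} = {x : f_j(x_k) + ⟨ḡ_{j,k}, x − x_k⟩ ≤ 0} if f_j(x_k) ≥ 0 and H_{j,k} = ℝ^n otherwise, one has max_{1≤j≤m} d(x_k, H_{j,k}) < h_k, and x_{k+1} = P_Q(x_k − (h_k/‖g_k‖) g_k) for some nonzero g_k ∈ ∂f(x_k); or (ii) x_{k+1} = P_Q(P_{H_k}(x_k))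 for some closed halfspace H_k with C ⊆ H_k and d(x_k, H_k) ≥ h_k. Then for every k ≥ 3 there exists an index i′ with 0 ≤ i′ ≤ k such that f(x_{i′}) − f(x*) ≤ √3·M₁·R/√(k − 1.5) and max_{1≤j≤m} f_j(x_{i′}) ≤ √3·M₂·R/√(k − 1.5). -/
open Metric Set
open scoped RealInnerProductSpace

/-- `p` is the metric projection of `y` onto the set `S`. -/
def IsProjOn {E : Type*} [NormedAddCommGroup E] [InnerProductSpace ℝ E]
    (S : Set E) (y p : E) : Prop :=
  p ∈ S ∧ ∀ q ∈ S, ‖p - y‖ ≤ ‖q - y‖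

/-- `s` is a subgradient of the convex function `g` at `x`. -/
def IsSubgradAt {E : Type*} [NormedAddCommGroup E] [InnerProductSpace ℝ E]
    (g : E → ℝ) (x s : E) : Prop :=
  ∀ y, g y ≥ g x + ⟪s, y - x⟫

/-- Pythagorean inequality for the metric projection onto a convex set. -/
theorem IsProjOn.sq_add_sq_le {E : Type*} [NormedAddCommGroup E] [InnerProductSpace ℝ E]
    {S : Set E} (hS : Convex ℝ S) {y p z : E} (hp : IsProjOn S y p) (hz : z ∈ S) :
    ‖p - z‖ ^ 2 + ‖p - y‖ ^ 2 ≤ ‖y - z‖ ^ 2 := by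
  have hmin : ‖y - p‖ = ⨅ w : S, ‖y - w‖ := by
    have : Nonempty S := ⟨⟨z, hz⟩⟩
    refine le_antisymm (le_ciInf fun w => ?_) (ciInf_le ⟨0, ?_⟩ (⟨p, hp.1⟩ : S))
    · simpa only [norm_sub_rev] using hp.2 w w.2
    · rintro _ ⟨w, rfl⟩
      exact norm_nonneg _
  have hinner := (norm_eq_iInf_iff_real_inner_le_zero hS hp.1).1 hmin z hz
  have hdecomp : y - z = (y - p) - (z - p) := by abel
  rw [hdecomp, norm_sub_sq_real (y - p) (z - p), norm_sub_rev p z, norm_sub_rev p y]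
  linarith

/-- The harmonic-type sum over `[a, a + N)` exceeds `1` as soon as `N > 2a`. -/
theorem one_lt_sum_inv_add_half {a N : ℕ} (hN : 2 * a < N) :
    1 < ∑ i ∈ Finset.range N, 1 / (((a + i : ℕ) : ℝ) + 0.5) := by
  have hN' : (2 * a + 1 : ℝ) ≤ N := by exact_mod_cast hN
  have ha : (0 : ℝ) ≤ a := a.cast_nonneg
  set c : ℝ := a + N / 2 with hc
  have hcpos : 0 < c := by linarith
  have hsum : ∀ K : ℕ, ∑ i ∈ Finset.range K, (2 / c - (((a + i : ℕ) : ℝ) + 0.5) / c ^ 2) =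
      K * (2 / c) - (K * a + K ^ 2 / 2) / c ^ 2 := by
    intro K
    induction K with
    | zero => simp
    | succ K ih =>
      rw [Finset.sum_range_succ, ih]
      push_cast
      ring
  have htangent : ∀ i ∈ Finset.range N,
      2 / c - (((a + i : ℕ) : ℝ) + 0.5) / c ^ 2 ≤ 1 / (((a + i : ℕ) : ℝ) + 0.5) := by
    intro i _
    have ht : (0 : ℝ) < ((a + i : ℕ) : ℝ) + 0.5 := by positivity
    generalize ((a + i : ℕ) : ℝ) + 0.5 = t at ht
    have hdiff : 1 / t - (2 / c - t / c ^ 2) = (t - c) ^ 2 / (t * c ^ 2) := by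
      field_simp
      ring
    have : 0 ≤ (t - c) ^ 2 / (t * c ^ 2) := by positivity
    linarith
  refine lt_of_lt_of_le ?_ (Finset.sum_le_sum htangent)
  rw [hsum]
  have hval : N * (2 / c) - (N * a + (N : ℝ) ^ 2 / 2) / c ^ 2 = N / c := by
    have : (N * a + (N : ℝ) ^ 2 / 2) = N * c := by rw [hc]; ring
    rw [this]
    field_simp
    ring
  rw [hval, lt_div_iff₀ hcpos]
  linarith

/-- Moving from `z` a distance at most `R` in the direction of a subgradient at `x` bounds
the gap `f x - f z` for a function that is Lipschitz on the ball around `z`. -/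
theorem IsSubgradAt.sub_le_of_inner_le {E : Type*} [NormedAddCommGroup E]
    [InnerProductSpace ℝ E] {f : E → ℝ} {x z g : E} {R M t : ℝ} (hR : 0 < R) (ht : 0 ≤ t)
    (hg0 : g ≠ 0) (hg : IsSubgradAt f x g) (hxz : ‖x - z‖ ≤ R)
    (hM : ∀ u ∈ closedBall z R, ∀ w ∈ closedBall z R, |f u - f w| ≤ M * ‖u - w‖)
    (hinner : ⟪g, x - z⟫ ≤ t * ‖g‖) : 0 ≤ M ∧ f x - f z ≤ M * t := by
  have hgpos : 0 < ‖g‖ := norm_pos_iff.2 hg0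
  have hz : z ∈ closedBall z R := mem_closedBall_self hR.le
  have hnorm : ∀ s : ℝ, 0 ≤ s → ‖(z + (s / ‖g‖) • g) - z‖ = s := by
    intro s hs
    rw [add_sub_cancel_left, norm_smul, Real.norm_of_nonneg (by positivity)]
    field_simp
  have hM0 : 0 ≤ M := by
    have := (abs_nonneg _).trans
      (hM (z + (R / ‖g‖) • g) (by rw [mem_closedBall_iff_norm, hnorm R hR.le]) z hz)
    rw [hnorm R hR.le] at this
    exact nonneg_of_mul_nonneg_left this hR
  refine ⟨hM0, ?_⟩
  have hsub : ∀ u, f x - f u ≤ ⟪g, x - u⟫ := by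
    intro u
    have := hg u
    rw [← neg_sub x u, inner_neg_right] at this
    linarith
  rcases le_total ⟪g, x - z⟫ 0 with hneg | hpos
  · exact ((hsub z).trans hneg).trans (mul_nonneg hM0 ht)
  · set v : ℝ := ⟪g, x - z⟫ / ‖g‖ with hv
    have hv0 : 0 ≤ v := by positivity
    have hvt : v ≤ t := (div_le_iff₀ hgpos).2 hinner
    have hvR : v ≤ R := by
      refine (div_le_iff₀ hgpos).2 ((real_inner_le_norm _ _).trans ?_)
      rw [mul_comm]
      gcongr
    have horth : ⟪g, x - (z + (v / ‖g‖) • g)⟫ = 0 := by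
      rw [← sub_sub, inner_sub_right, inner_smul_right, real_inner_self_eq_norm_sq, hv]
      field_simp
      ring
    have hfx := hsub (z + (v / ‖g‖) • g)
    rw [horth] at hfx
    have hLip := (le_abs_self _).trans
      (hM (z + (v / ‖g‖) • g) (by rwa [mem_closedBall_iff_norm, hnorm v hv0]) z hz)
    rw [hnorm v hv0] at hLip
    have := mul_le_mul_of_nonneg_left hvt hM0
    linarith

/-- If the linearized constraint set of `φ` at `x` contains some point and is closer to `x`
than `t`, then `φ x` is at most `M * t` for any bound `M` on the norm of the subgradient. -/
theorem le_mul_of_infDist_linearization_lt {E : Type*} [NormedAddCommGroup E]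
    [InnerProductSpace ℝ E] {φ : E → ℝ} {x z s : E} {M t : ℝ} (hs : IsSubgradAt φ x s)
    (hz : φ z ≤ 0) (hsM : ‖s‖ ≤ M) (ht : 0 ≤ t)
    (hdist : infDist x {y : E | 0 ≤ φ x → φ x + ⟪s, y - x⟫ ≤ 0} < t) : φ x ≤ M * t := by
  have hM : 0 ≤ M := (norm_nonneg s).trans hsM
  rcases le_total (φ x) 0 with hneg | hpos
  · exact hneg.trans (mul_nonneg hM ht)
  · have hne : {y : E | 0 ≤ φ x → φ x + ⟪s, y - x⟫ ≤ 0}.Nonempty :=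
      ⟨z, fun _ => (hs z).le.trans hz⟩
    obtain ⟨y, hy, hyt⟩ := (infDist_lt_iff hne).1 hdist
    have hlin := hy hpos
    have hcs := real_inner_le_norm s (x - y)
    rw [← neg_sub y x, inner_neg_right, norm_neg, norm_sub_rev, ← dist_eq_norm] at hcs
    have : ‖s‖ * dist x y ≤ M * t := mul_le_mul hsM hyt.le dist_nonneg hM
    linarith

/-- A normalized subgradient step of length `t` followed by projection decreases the squared
distance to `z` by `t ^ 2` when the subgradient has large inner product with `x - z`. -/
theorem IsProjOn.sq_le_of_subgradient_step {E : Type*} [NormedAddCommGroup E]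
    [InnerProductSpace ℝ E] {Q : Set E} (hQ : Convex ℝ Q) {x x' z g : E} {t : ℝ}
    (ht : 0 ≤ t) (hg0 : g ≠ 0) (hz : z ∈ Q) (hx' : IsProjOn Q (x - (t / ‖g‖) • g) x')
    (hinner : t * ‖g‖ ≤ ⟪g, x - z⟫) : ‖x' - z‖ ^ 2 ≤ ‖x - z‖ ^ 2 - t ^ 2 := by
  have hgpos : 0 < ‖g‖ := norm_pos_iff.2 hg0
  have hproj := hx'.sq_add_sq_le hQ hz
  have hnorm : ‖(t / ‖g‖) • g‖ = t := by
    rw [norm_smul, Real.norm_of_nonneg (by positivity)]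
    field_simp
  have hlarge : t ^ 2 ≤ ⟪x - z, (t / ‖g‖) • g⟫ := by
    rw [inner_smul_right, real_inner_comm]
    calc t ^ 2 = t / ‖g‖ * (t * ‖g‖) := by field_simp
      _ ≤ _ := by gcongr
  rw [sub_right_comm, norm_sub_sq_real (x - z), hnorm] at hproj
  nlinarith [sq_nonneg ‖x' - (x - (t / ‖g‖) • g)‖]

/-- Projecting first onto a convex set `H` at distance at least `t` and then onto `Q`
decreases the squared distance to every point of `Q ∩ H` by `t ^ 2`. -/
theorem IsProjOn.sq_le_of_feasibility_step {E : Type*} [NormedAddCommGroup E]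
    [InnerProductSpace ℝ E] {Q H : Set E} (hQ : Convex ℝ Q) (hH : Convex ℝ H)
    {x q x' z : E} {t : ℝ} (ht : 0 ≤ t) (hzQ : z ∈ Q) (hzH : z ∈ H)
    (hdist : t ≤ infDist x H) (hq : IsProjOn H x q) (hx' : IsProjOn Q q x') :
    ‖x' - z‖ ^ 2 ≤ ‖x - z‖ ^ 2 - t ^ 2 := by
  have hprojQ := hx'.sq_add_sq_le hQ hzQ
  have hprojH := hq.sq_add_sq_le hH hzH
  have htq : t ≤ ‖q - x‖ := by
    rw [norm_sub_rev, ← dist_eq_norm]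
    exact hdist.trans (infDist_le_dist_of_mem hq.1)
  have := pow_le_pow_left₀ ht htq 2
  linarith [sq_nonneg ‖x' - q‖]

/-- Theorem 3.5(a): convergence of the subgradient algorithm with feasibility updates
(Step 1A). For every `k ≥ 3` there is an index `i′ ≤ k` with
`f(x_{i′}) − f(x*) ≤ √3 M₁ R / √(k − 1.5)` and
`f_j(x_{i′}) ≤ √3 M₂ R / √(k − 1.5)` for all `j`. -/
theorem subgradient_algorithm_with_feasibility_rate {n m : ℕ}
    (f : EuclideanSpace ℝ (Fin n) → ℝ)
    (fj : Fin m → EuclideanSpace ℝ (Fin n) → ℝ)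
    (hf : ConvexOn ℝ Set.univ f) (hfj : ∀ j, ConvexOn ℝ Set.univ (fj j))
    (Q : Set (EuclideanSpace ℝ (Fin n)))
    (hQne : Q.Nonempty) (hQclosed : IsClosed Q) (hQconv : Convex ℝ Q)
    (R : ℝ) (hR : 0 < R)
    (hQbdd : ∀ x ∈ Q, ∀ y ∈ Q, ‖x - y‖ ≤ R)
    (C : Set (EuclideanSpace ℝ (Fin n)))
    (hC : C = ⋂ j : Fin m, {x : EuclideanSpace ℝ (Fin n) | fj j x ≤ 0})
    (xstar : EuclideanSpace ℝ (Fin n)) (hxstarQ : xstar ∈ Q) (hxstarC : xstar ∈ C)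
    (hopt : ∀ y ∈ Q ∩ C, f xstar ≤ f y)
    (M₁ M₂ : ℝ)
    (hM₁ : ∀ x ∈ closedBall xstar R, ∀ y ∈ closedBall xstar R,
      |f x - f y| ≤ M₁ * ‖x - y‖)
    (hM₂ : ∀ j : Fin m, ∀ x ∈ closedBall xstar R,
      ∀ s : EuclideanSpace ℝ (Fin n), IsSubgradAt (fj j) x s → ‖s‖ ≤ M₂)
    (h : ℕ → ℝ) (hh : ∀ k : ℕ, h k = R / Real.sqrt ((k : ℝ) + 0.5))
    (x : ℕ → EuclideanSpace ℝ (Fin n)) (hxQ : ∀ k, x k ∈ Q)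
    (hstep : ∀ k : ℕ,
      -- line 06: all linearized constraint halfspaces are closer than `h k`, and a
      -- subgradient step on `f` followed by projection onto `Q` is taken
      (∃ g : Fin m → EuclideanSpace ℝ (Fin n),
        (∀ j, IsSubgradAt (fj j) (x k) (g j)) ∧
        (∀ j, infDist (x k)
          {y : EuclideanSpace ℝ (Fin n) |
            0 ≤ fj j (x k) → fj j (x k) + ⟪g j, y - x k⟫ ≤ 0} < h k) ∧
        ∃ gk : EuclideanSpace ℝ (Fin n), gk ≠ 0 ∧ IsSubgradAt f (x k) gk ∧
          IsProjOn Q (x k - (h k / ‖gk‖) • gk) (x (k + 1)))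
      ∨
      -- lines 07–08: a separating halfspace `H` containing `C` at distance at least
      -- `h k` is found, and a feasibility step is taken
      (∃ H : Set (EuclideanSpace ℝ (Fin n)),
        (∃ (a : EuclideanSpace ℝ (Fin n)) (b : ℝ), a ≠ 0 ∧ H = {y | ⟪a, y⟫ ≤ b}) ∧
        C ⊆ H ∧ h k ≤ infDist (x k) H ∧
        ∃ q : EuclideanSpace ℝ (Fin n), IsProjOn H (x k) q ∧ IsProjOn Q q (x (k + 1)))) :
    ∀ k : ℕ, 3 ≤ k → ∃ i : ℕ, i ≤ k ∧
      f (x i) - f xstar ≤ Real.sqrt 3 * M₁ * R / Real.sqrt ((k : ℝ) - 1.5) ∧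
      ∀ j : Fin m, fj j (x i) ≤ Real.sqrt 3 * M₂ * R / Real.sqrt ((k : ℝ) - 1.5) := by
  intro k hk
  have hpos : ∀ i, 0 < h i := fun i => by rw [hh]; positivity
  have hsq : ∀ i, h i ^ 2 = R ^ 2 * (1 / ((i : ℝ) + 0.5)) := fun i => by
    rw [hh, div_pow, Real.sq_sqrt (by positivity)]
    ring
  have hball : ∀ i, x i ∈ closedBall xstar R := fun i => by
    rw [mem_closedBall_iff_norm]
    exact hQbdd _ (hxQ i) _ hxstarQ
  obtain ⟨a, ha⟩ : ∃ a, a = k / 3 := ⟨_, rfl⟩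
  have hbound : ∀ i, a ≤ i → h i ≤ Real.sqrt 3 * R / Real.sqrt ((k : ℝ) - 1.5) := by
    intro i hi
    have hk' : (3 : ℝ) ≤ k := by exact_mod_cast hk
    have hki : (k : ℝ) ≤ 3 * i + 2 := by exact_mod_cast (by omega : k ≤ 3 * i + 2)
    have hroot : Real.sqrt ((k : ℝ) - 1.5) ≤ Real.sqrt 3 * Real.sqrt ((i : ℝ) + 0.5) := by
      rw [← Real.sqrt_mul (by norm_num)]
      exact Real.sqrt_le_sqrt (by linarith)
    rw [hh, div_le_div_iff₀ (Real.sqrt_pos.2 (by positivity))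
      (Real.sqrt_pos.2 (by linarith))]
    calc R * Real.sqrt ((k : ℝ) - 1.5)
        ≤ R * (Real.sqrt 3 * Real.sqrt ((i : ℝ) + 0.5)) := by gcongr
      _ = Real.sqrt 3 * R * Real.sqrt ((i : ℝ) + 0.5) := by ring
  obtain ⟨i, hai, hik, hnodec⟩ : ∃ i, a ≤ i ∧ i ≤ k ∧
      ¬ ‖x (i + 1) - xstar‖ ^ 2 ≤ ‖x i - xstar‖ ^ 2 - h i ^ 2 := by
    by_contra! hdec
    have htelescope : ∀ N, a + N ≤ k + 1 → ‖x (a + N) - xstar‖ ^ 2 ≤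
        ‖x a - xstar‖ ^ 2 - ∑ i ∈ Finset.range N, h (a + i) ^ 2 := by
      intro N
      induction N with
      | zero => simp
      | succ N ih =>
        intro hN
        rw [Finset.sum_range_succ, ← add_assoc]
        linarith [ih (by omega), hdec (a + N) (by omega) (by omega)]
    have htotal := htelescope (k + 1 - a) (by omega)
    simp only [hsq] at htotal
    rw [← Finset.mul_sum] at htotal
    have hsum := one_lt_sum_inv_add_half (a := a) (N := k + 1 - a) (by omega)
    have hstart := pow_le_pow_left₀ (norm_nonneg _) (hQbdd _ (hxQ a) _ hxstarQ) 2
    nlinarith [sq_nonneg ‖x (a + (k + 1 - a)) - xstar‖, pow_pos hR 2]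
  refine ⟨i, hik, ?_⟩
  rcases hstep i with ⟨g, hg, hgdist, gk, hgk0, hgk, hproj⟩ |
    ⟨H, ⟨b, c, -, rfl⟩, hCH, hdist, q, hq, hproj⟩
  · have hinner : ⟪gk, x i - xstar⟫ ≤ h i * ‖gk‖ := by
      by_contra! hlarge
      exact hnodec (hproj.sq_le_of_subgradient_step hQconv (hpos i).le hgk0 hxstarQ hlarge.le)
    obtain ⟨hM₁0, hgap⟩ := hgk.sub_le_of_inner_le hR (hpos i).le hgk0
      (hQbdd _ (hxQ i) _ hxstarQ) hM₁ hinner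
    constructor
    · calc f (x i) - f xstar ≤ M₁ * h i := hgap
        _ ≤ M₁ * (Real.sqrt 3 * R / Real.sqrt ((k : ℝ) - 1.5)) := by
          gcongr
          exact hbound i hai
        _ = _ := by ring
    · intro j
      have hgM := hM₂ j (x i) (hball i) (g j) (hg j)
      have hM₂0 : 0 ≤ M₂ := (norm_nonneg _).trans hgM
      have hfeas : fj j xstar ≤ 0 := by
        rw [hC] at hxstarC
        exact mem_iInter.1 hxstarC j
      calc fj j (x i) ≤ M₂ * h i :=
            le_mul_of_infDist_linearization_lt (hg j) hfeas hgM (hpos i).le (hgdist j)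
        _ ≤ M₂ * (Real.sqrt 3 * R / Real.sqrt ((k : ℝ) - 1.5)) := by
          gcongr
          exact hbound i hai
        _ = _ := by ring
  · have hconv : Convex ℝ {y : EuclideanSpace ℝ (Fin n) | ⟪b, y⟫ ≤ c} :=
      convex_halfSpace_le (innerₛₗ ℝ b).isLinear c
    exact absurd (hq.sq_le_of_feasibility_step hQconv hconv (hpos i).le hxstarQ
      (hCH hxstarC) hdist hproj) hnodec
end

section
/- Let {δ_k}_{k≥1} be a sequence of nonnegative real numbers satisfying δ_{k+1} ≤ δ_k − ε₁·[1 − √(1 − ε₂ δ_k)]² + α/k² for all k ≥ 1, where ε₁, ε₂ > 0, α ≥ 0, and ε₂ δ_k ≤ 1 for all k. Then the convergence of {δ_k} to zero is O(1/k); that is, there exists a constant c > 0 such that δ_k ≤ c/k for all k ≥ 1. -/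
/-- A nonnegative sequence with `u (k + 1) ≤ u k - b * u k ^ 2 + a / k ^ 2` is `O(1 / k)`, with an
explicit constant. -/
lemma le_div_of_quadratic_recurrence {u : ℕ → ℝ} {a b c : ℝ} (hb : 0 < b) (ha : 0 ≤ a)
    (hu : ∀ k : ℕ, 1 ≤ k → 0 ≤ u k)
    (hrec : ∀ k : ℕ, 1 ≤ k → u (k + 1) ≤ u k - b * u k ^ 2 + a / (k : ℝ) ^ 2)
    (hc₁ : u 1 ≤ c) (hc : 2 * (1 / b + a) ≤ c) (k : ℕ) (hk : 1 ≤ k) :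
    u k ≤ c / (k : ℝ) := by
  -- Linearise the quadratic term along its tangent line at `1 / (b * k)`.
  have hlin : ∀ k : ℕ, 1 ≤ k →
      u (k + 1) ≤ u k * (1 - 2 / (k : ℝ)) + (1 / b + a) / (k : ℝ) ^ 2 := by
    intro k hk
    have hk0 : (0 : ℝ) < k := by exact_mod_cast hk
    have htangent : u k * (1 - 2 / (k : ℝ)) + (1 / b + a) / (k : ℝ) ^ 2
        - (u k - b * u k ^ 2 + a / (k : ℝ) ^ 2) = b * (u k - 1 / (b * k)) ^ 2 := by
      field_simp
      ring
    have hsq : 0 ≤ b * (u k - 1 / (b * k)) ^ 2 := by positivity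
    linarith [hrec k hk]
  have hA : 0 < 1 / b + a := by positivity
  induction k, hk using Nat.le_induction with
  | base => simpa using hc₁
  | succ k hk ih =>
    have hstep := hlin k hk
    obtain rfl | hk2 := hk.eq_or_lt
    · have := hu 1 le_rfl
      norm_num at hstep ⊢
      norm_num at hc
      linarith
    · have hk2' : (2 : ℝ) ≤ k := by exact_mod_cast hk2
      have hk0 : (0 : ℝ) < k := by linarith
      have hfactor : 0 ≤ 1 - 2 / (k : ℝ) := by
        rw [sub_nonneg, div_le_one hk0]
        exact hk2'
      have hmono := mul_le_mul_of_nonneg_right ih hfactor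
      have hgap : c / ((k + 1 : ℕ) : ℝ)
          - (c / k * (1 - 2 / (k : ℝ)) + (1 / b + a) / (k : ℝ) ^ 2)
          = ((c - (1 / b + a)) * (k + 1) + c) / ((k : ℝ) ^ 2 * (k + 1)) := by
        push_cast
        field_simp
        ring
      have hgap_nonneg :
          0 ≤ ((c - (1 / b + a)) * (k + 1) + c) / ((k : ℝ) ^ 2 * (k + 1)) := by
        have h₁ : 0 ≤ c - (1 / b + a) := by linarith
        have h₂ : 0 ≤ c := by linarith
        positivity
      linarith

lemma half_le_one_sub_sqrt_one_sub {x : ℝ} (hx : x ≤ 1) : x / 2 ≤ 1 - √(1 - x) := by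
  nlinarith [Real.sq_sqrt (sub_nonneg.2 hx), sq_nonneg (√(1 - x) - 1)]

/-- Lemma 4.5(a): a nonnegative sequence satisfying the perturbed recurrence
`δ_{k+1} ≤ δ_k − ε₁ (1 − √(1 − ε₂ δ_k))² + α/k²` converges to zero at rate `O(1/k)`. -/
theorem sequence_rate_O_one_div_k
    (δ : ℕ → ℝ) (ε₁ ε₂ α : ℝ) (hε₁ : 0 < ε₁) (hε₂ : 0 < ε₂) (hα : 0 ≤ α)
    (hδnonneg : ∀ k : ℕ, 1 ≤ k → 0 ≤ δ k)
    (hδbdd : ∀ k : ℕ, 1 ≤ k → ε₂ * δ k ≤ 1)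
    (hrec : ∀ k : ℕ, 1 ≤ k →
      δ (k + 1) ≤ δ k - ε₁ * (1 - Real.sqrt (1 - ε₂ * δ k)) ^ 2 + α / (k : ℝ) ^ 2) :
    ∃ c : ℝ, 0 < c ∧ ∀ k : ℕ, 1 ≤ k → δ k ≤ c / (k : ℝ) := by
  have hb : 0 < ε₁ * ε₂ ^ 2 / 4 := by positivity
  refine ⟨1 / ε₂ + 2 * (1 / (ε₁ * ε₂ ^ 2 / 4) + α), by positivity,
    le_div_of_quadratic_recurrence hb hα hδnonneg (fun k hk => ?_) ?_ ?_⟩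
  · have hx : 0 ≤ ε₂ * δ k / 2 := by
      have := hδnonneg k hk
      positivity
    have hsq := mul_le_mul_of_nonneg_left
      (pow_le_pow_left₀ hx (half_le_one_sub_sqrt_one_sub (hδbdd k hk)) 2) hε₁.le
    linarith [hrec k hk]
  · have h₁ : δ 1 ≤ 1 / ε₂ := by
      rw [le_div_iff₀ hε₂, mul_comm]
      exact hδbdd 1 le_rfl
    have hA : 0 < 1 / (ε₁ * ε₂ ^ 2 / 4) + α := by positivity
    linarith
  · have : 0 < 1 / ε₂ := by positivity
    linarith
end

section
/- Let f : ℝ^n → ℝ be differentiable and strongly convex with parameter μ > 0. Let x̄, x ∈ ℝ^n be such that f(x) < f(x̄) and f′(x̄) ≠ 0, and define the halfspace H̄ = {y : ⟨f′(x̄), y − x̄⟩ ≥ 0}. Then d(x, H̄) ≥ (1/μ)·[‖f′(x̄)‖ − √(‖f′(x̄)‖² − 2μ·(f(x̄) − f(x)))]. (In particular ‖f′(x̄)‖² − 2μ·(f(x̄) − f(x)) ≥ 0.) -/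
open Metric Set
open scoped RealInnerProductSpace

/-- Lemma 4.6(a): distance to a supporting halfspace for a strongly convex function.
If `f` is differentiable and strongly convex with parameter `μ`, `f x < f x̄` and
`f′(x̄) ≠ 0`, then with `H̄ = {y : ⟪f′(x̄), y − x̄⟫ ≥ 0}` one has
`d(x, H̄) ≥ (1/μ)(‖f′(x̄)‖ − √(‖f′(x̄)‖² − 2μ(f(x̄) − f(x))))`, the radicand being
nonnegative. -/
theorem dist_to_supporting_halfspace {n : ℕ}
    (f : EuclideanSpace ℝ (Fin n) → ℝ)
    (f' : EuclideanSpace ℝ (Fin n) → EuclideanSpace ℝ (Fin n))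
    (μ : ℝ) (hμ : 0 < μ)
    (hgrad : ∀ x, HasGradientAt f (f' x) x)
    (hsc : ∀ x y : EuclideanSpace ℝ (Fin n),
      f y ≥ f x + ⟪f' x, y - x⟫ + μ / 2 * ‖x - y‖ ^ 2)
    (xbar x : EuclideanSpace ℝ (Fin n)) (hlt : f x < f xbar) (hne : f' xbar ≠ 0) :
    0 ≤ ‖f' xbar‖ ^ 2 - 2 * μ * (f xbar - f x) ∧
    infDist x {y : EuclideanSpace ℝ (Fin n) | 0 ≤ ⟪f' xbar, y - xbar⟫} ≥
      1 / μ * (‖f' xbar‖ - Real.sqrt (‖f' xbar‖ ^ 2 - 2 * μ * (f xbar - f x))) := by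
  set G := ‖f' xbar‖
  have hG : 0 < G := norm_pos_iff.mpr hne
  obtain ⟨D, hD⟩ : ∃ D, D * G = -⟪f' xbar, x - xbar⟫ := ⟨_, div_mul_cancel₀ _ hG.ne'⟩
  have hDG : f xbar - f x + μ / 2 * ‖x - xbar‖ ^ 2 ≤ D * G := by
    have h := hsc xbar x
    rw [norm_sub_rev xbar x] at h
    linarith
  have hDpos : 0 < D :=
    pos_of_mul_pos_left (lt_of_lt_of_le (by nlinarith [sq_nonneg ‖x - xbar‖]) hDG) hG.le
  have hDr : D ≤ ‖x - xbar‖ := by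
    refine le_of_mul_le_mul_right ?_ hG
    have h := neg_le_of_abs_le (abs_real_inner_le_norm (f' xbar) (x - xbar))
    rw [hD, mul_comm]
    linarith
  have hsq : (G - μ * D) ^ 2 ≤ G ^ 2 - 2 * μ * (f xbar - f x) := by
    have hD2 : D ^ 2 ≤ ‖x - xbar‖ ^ 2 := pow_le_pow_left₀ hDpos.le hDr 2
    have h : f xbar - f x + μ / 2 * D ^ 2 ≤ D * G := by nlinarith
    nlinarith
  refine ⟨(sq_nonneg _).trans hsq, ?_⟩
  have hbound : 1 / μ * (G - Real.sqrt (G ^ 2 - 2 * μ * (f xbar - f x))) ≤ D := by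
    rw [one_div_mul_eq_div, div_le_iff₀ hμ]
    linarith [Real.le_sqrt_of_sq_le hsq]
  refine hbound.trans ((le_infDist ⟨xbar, by simp⟩).mpr fun y hy => ?_)
  refine le_of_mul_le_mul_right ?_ hG
  have hy' : 0 ≤ ⟪f' xbar, y - xbar⟫ := hy
  have h := real_inner_le_norm (f' xbar) (y - x)
  rw [← sub_sub_sub_cancel_right y x xbar, inner_sub_right, sub_sub_sub_cancel_right] at h
  rw [hD, dist_comm, dist_eq_norm, mul_comm]
  linarith
end

section
/- Let f : ℝ → ℝ be defined by f(x) = max{x, 2x − 1}, and let y = 0.9, z = 1.1. Then 1 ∈ ∂f(y) and 2 ∈ ∂f(z); the associated halfspaces are H_y = {x : f(y) + 1·(x − y) ≤ 0} = (−∞, 0] and H_z = {x : f(z) + 2·(x − z) ≤ 0} = (−∞, 0.5]; and d(y, H_y) = 0.9, d(z, H_z) = 0.6, |y − z| = 0.2, so that d(y, H_y) > |y − z| + d(z, H_z). In particular, the triangular property fails for this convex function f. -/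
open Metric Set

/-- The distance from a point `a ≥ b` to the half-line `(-∞, b]` is `a - b`. -/
theorem infDist_Iic_of_le {a b : ℝ} (hab : b ≤ a) : infDist a (Set.Iic b) = a - b := by
  apply le_antisymm
  · calc infDist a (Set.Iic b) ≤ dist a b := infDist_le_dist_of_mem Set.self_mem_Iic
      _ = a - b := by rw [Real.dist_eq, abs_of_nonneg (sub_nonneg.2 hab)]
  · refine (le_infDist Set.nonempty_Iic).2 fun x hx => ?_
    rw [Real.dist_eq]
    exact (sub_le_sub_left (Set.mem_Iic.1 hx) a).trans (le_abs_self _)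

/-- Example 4.8: failure of the triangular property for `f(x) = max{x, 2x − 1}` at
`y = 0.9`, `z = 1.1`: `1 ∈ ∂f(y)`, `2 ∈ ∂f(z)`, the associated halfspaces are
`(−∞, 0]` and `(−∞, 0.5]`, with `d(y, H_y) = 0.9`, `d(z, H_z) = 0.6`, `|y − z| = 0.2`,
so that `d(y, H_y) > |y − z| + d(z, H_z)`. -/
theorem triangular_property_fails
    (f : ℝ → ℝ) (hf : ∀ x, f x = max x (2 * x - 1)) :
    (∀ t : ℝ, f t ≥ f 0.9 + 1 * (t - 0.9)) ∧
    (∀ t : ℝ, f t ≥ f 1.1 + 2 * (t - 1.1)) ∧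
    {x : ℝ | f 0.9 + 1 * (x - 0.9) ≤ 0} = Set.Iic (0 : ℝ) ∧
    {x : ℝ | f 1.1 + 2 * (x - 1.1) ≤ 0} = Set.Iic (0.5 : ℝ) ∧
    infDist (0.9 : ℝ) {x : ℝ | f 0.9 + 1 * (x - 0.9) ≤ 0} = 0.9 ∧
    infDist (1.1 : ℝ) {x : ℝ | f 1.1 + 2 * (x - 1.1) ≤ 0} = 0.6 ∧
    |(0.9 : ℝ) - 1.1| = 0.2 ∧
    infDist (0.9 : ℝ) {x : ℝ | f 0.9 + 1 * (x - 0.9) ≤ 0} >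
      |(0.9 : ℝ) - 1.1| + infDist (1.1 : ℝ) {x : ℝ | f 1.1 + 2 * (x - 1.1) ≤ 0} := by
  have hy : f 0.9 = 0.9 := by rw [hf, max_eq_left]; norm_num
  have hz : f 1.1 = 1.2 := by rw [hf, max_eq_right] <;> norm_num
  have hHy : {x : ℝ | f 0.9 + 1 * (x - 0.9) ≤ 0} = Set.Iic (0 : ℝ) := by
    ext x
    rw [Set.mem_ofPred_eq, Set.mem_Iic, hy]
    constructor <;> intro h <;> linarith
  have hHz : {x : ℝ | f 1.1 + 2 * (x - 1.1) ≤ 0} = Set.Iic (0.5 : ℝ) := by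
    ext x
    rw [Set.mem_ofPred_eq, Set.mem_Iic, hz]
    constructor <;> intro h <;> linarith
  have hdist : |(0.9 : ℝ) - 1.1| = 0.2 := by
    rw [abs_of_neg] <;> norm_num
  have hdy : infDist (0.9 : ℝ) (Set.Iic 0) = 0.9 := by
    rw [infDist_Iic_of_le] <;> norm_num
  have hdz : infDist (1.1 : ℝ) (Set.Iic 0.5) = 0.6 := by
    rw [infDist_Iic_of_le] <;> norm_num
  rw [hHy, hHz, hdy, hdz, hdist, hy, hz]
  refine ⟨fun t => ?_, fun t => ?_, rfl, rfl, rfl, rfl, rfl, by norm_num⟩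
  · rw [hf]
    linarith [le_max_left t (2 * t - 1)]
  · rw [hf]
    linarith [le_max_right t (2 * t - 1)]
end

section
/- Let f : ℝ^n → ℝ be differentiable and strongly convex with parameter μ > 0, let C ⊆ ℝ^n be a nonempty closed convex set, let x* be the minimizer of f over C, and suppose f′(x*) ≠ 0. Let κ > 0 and let {x_k}_{k≥0} be a sequence such that for every k: (i) f(x_k) < f(x*); (ii) ⟨f′(x_k), x_{k+1} − x_k⟩ ≥ 0; (iii) ‖x_{k+1} − x_k‖ ≥ (1/κ)·d(x_k, C); and (iv) ⟨f′(x_k), x* − x_k⟩ ≥ 0. Then, with ε̄ = μ/(2κ²‖f′(x*)‖²), one has f(x*) − f(x_k) ≤ 1/( 1/(f(x*) − f(x₀)) + ε̄·k ) for all k ≥ 0, and ‖x* − x_k‖ ≤ √((2/μ)·(f(x*) − f(x_k))). In particular f(x_k) → f(x*) at rate O(1/k) and x_k → x* at rate O(1/√k). -/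
open Metric
open scoped RealInnerProductSpace

/-- First-order optimality condition for a minimizer over a convex set. -/
theorem inner_gradient_sub_nonneg_of_isMinOn {E : Type*} [NormedAddCommGroup E]
    [InnerProductSpace ℝ E] [CompleteSpace E] {f : E → ℝ} {g a y : E} {C : Set E}
    (hC : Convex ℝ C) (hf : HasGradientAt f g a) (hmin : IsMinOn f C a)
    (ha : a ∈ C) (hy : y ∈ C) : 0 ≤ ⟪g, y - a⟫ := by
  have h := hmin.localize.hasFDerivWithinAt_nonneg hf.hasFDerivAt.hasFDerivWithinAt
    (sub_mem_posTangentConeAt_of_segment_subset (hC.segment_subset ha hy))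
  simpa using h

/-- If `⟪g, y - a⟫ ≥ 0` for all `y ∈ C`, then `⟪g, a - x⟫ ≤ ‖g‖ d(x, C)`. -/
theorem inner_sub_le_norm_mul_infDist {E : Type*} [NormedAddCommGroup E]
    [InnerProductSpace ℝ E] {g a x : E} {C : Set E} (hC : C.Nonempty) (hg : g ≠ 0)
    (h : ∀ y ∈ C, 0 ≤ ⟪g, y - a⟫) : ⟪g, a - x⟫ ≤ ‖g‖ * infDist x C := by
  have hg' : 0 < ‖g‖ := norm_pos_iff.mpr hg
  rw [← div_le_iff₀' hg', le_infDist hC]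
  intro y hy
  rw [div_le_iff₀' hg', dist_comm, dist_eq_norm]
  calc ⟪g, a - x⟫ ≤ ⟪g, y - a⟫ + ⟪g, a - x⟫ := le_add_of_nonneg_left (h y hy)
    _ = ⟪g, y - x⟫ := by rw [← inner_add_right, sub_add_sub_cancel]
    _ ≤ ‖g‖ * ‖y - x‖ := real_inner_le_norm _ _

/-- A positive sequence with `a (k + 1) ≤ a k - ε * a k ^ 2` decays like `1 / (ε * k)`. -/
theorem le_one_div_of_le_sub_mul_sq {a : ℕ → ℝ} {ε : ℝ} (hε : 0 ≤ ε) (ha : ∀ k, 0 < a k)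
    (hstep : ∀ k, a (k + 1) ≤ a k - ε * a k ^ 2) (k : ℕ) :
    a k ≤ 1 / (1 / a 0 + ε * k) := by
  have hinv : 1 / a 0 + ε * k ≤ 1 / a k := by
    induction k with
    | zero => simp
    | succ k ih =>
      have hk := ha k
      have hk' := ha (k + 1)
      have hmono : a (k + 1) ≤ a k :=
        (hstep k).trans (sub_le_self _ (by positivity))
      have hrec : 1 / a k + ε ≤ 1 / a (k + 1) := by
        rw [div_add' _ _ _ hk.ne', div_le_div_iff₀ hk hk']
        nlinarith [hstep k, mul_le_mul_of_nonneg_left hmono (mul_nonneg hε hk.le)]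
      push_cast
      linarith
  have h0 := ha 0
  exact (le_one_div (by positivity) (ha k)).mp hinv

/-- Theorem 4.9(a) (abstract generalized Haugazeau algorithm): if `f` is differentiable
and strongly convex with parameter `μ`, `x*` minimizes `f` over the nonempty closed
convex set `C`, `f′(x*) ≠ 0`, and the iterates satisfy
(i) `f(x_k) < f(x*)`, (ii) `⟪f′(x_k), x_{k+1} − x_k⟫ ≥ 0`,
(iii) `‖x_{k+1} − x_k‖ ≥ (1/κ) d(x_k, C)`, (iv) `⟪f′(x_k), x* − x_k⟫ ≥ 0`,
then with `ε̄ = μ/(2κ²‖f′(x*)‖²)` one has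
`f(x*) − f(x_k) ≤ 1/(1/(f(x*) − f(x₀)) + ε̄ k)` and
`‖x* − x_k‖ ≤ √((2/μ)(f(x*) − f(x_k)))`. -/
theorem generalized_haugazeau_rate {n : ℕ}
    (f : EuclideanSpace ℝ (Fin n) → ℝ)
    (f' : EuclideanSpace ℝ (Fin n) → EuclideanSpace ℝ (Fin n))
    (μ : ℝ) (hμ : 0 < μ)
    (hgrad : ∀ x, HasGradientAt f (f' x) x)
    (hsc : ∀ x y : EuclideanSpace ℝ (Fin n),
      f y ≥ f x + ⟪f' x, y - x⟫ + μ / 2 * ‖x - y‖ ^ 2)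
    (C : Set (EuclideanSpace ℝ (Fin n))) (hCne : C.Nonempty)
    (hCclosed : IsClosed C) (hCconv : Convex ℝ C)
    (xstar : EuclideanSpace ℝ (Fin n)) (hxstarC : xstar ∈ C)
    (hopt : ∀ y ∈ C, f xstar ≤ f y) (hne : f' xstar ≠ 0)
    (κ : ℝ) (hκ : 0 < κ)
    (x : ℕ → EuclideanSpace ℝ (Fin n))
    (h1 : ∀ k : ℕ, f (x k) < f xstar)
    (h2 : ∀ k : ℕ, 0 ≤ ⟪f' (x k), x (k + 1) - x k⟫)
    (h3 : ∀ k : ℕ, 1 / κ * infDist (x k) C ≤ ‖x (k + 1) - x k‖)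
    (h4 : ∀ k : ℕ, 0 ≤ ⟪f' (x k), xstar - x k⟫) :
    ∀ k : ℕ,
      f xstar - f (x k) ≤
        1 / (1 / (f xstar - f (x 0)) + μ / (2 * κ ^ 2 * ‖f' xstar‖ ^ 2) * (k : ℝ)) ∧
      ‖xstar - x k‖ ≤ Real.sqrt (2 / μ * (f xstar - f (x k))) := by
  intro k
  have hg : 0 < ‖f' xstar‖ := norm_pos_iff.mpr hne
  have hgap : ∀ k, f xstar - f (x k) ≤ ‖f' xstar‖ * infDist (x k) C := fun k => by
    have hdist := inner_sub_le_norm_mul_infDist (x := x k) hCne hne fun y hy =>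
      inner_gradient_sub_nonneg_of_isMinOn hCconv (hgrad xstar) (isMinOn_iff.mpr hopt) hxstarC hy
    have hconv := hsc xstar (x k)
    rw [← neg_sub xstar (x k), inner_neg_right] at hconv
    have hsq : 0 ≤ μ / 2 * ‖xstar - x k‖ ^ 2 := by positivity
    linarith
  have hstep : ∀ k, f xstar - f (x (k + 1)) ≤ f xstar - f (x k) -
      μ / (2 * κ ^ 2 * ‖f' xstar‖ ^ 2) * (f xstar - f (x k)) ^ 2 := fun k => by
    have hlen : (f xstar - f (x k)) / (κ * ‖f' xstar‖) ≤ ‖x (k + 1) - x k‖ := by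
      refine le_trans ?_ (h3 k)
      rw [div_le_iff₀ (by positivity)]
      refine (hgap k).trans_eq ?_
      field_simp
    have hsq := pow_le_pow_left₀
      (div_nonneg (sub_nonneg.mpr (h1 k).le) (by positivity)) hlen 2
    have hmul := mul_le_mul_of_nonneg_left hsq (half_pos hμ).le
    have heq : μ / 2 * ((f xstar - f (x k)) / (κ * ‖f' xstar‖)) ^ 2 =
        μ / (2 * κ ^ 2 * ‖f' xstar‖ ^ 2) * (f xstar - f (x k)) ^ 2 := by
      field_simp
    have hconv := hsc (x k) (x (k + 1))
    rw [norm_sub_rev] at hconv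
    linarith [h2 k]
  refine ⟨le_one_div_of_le_sub_mul_sq (a := fun k => f xstar - f (x k)) (by positivity)
    (fun k => sub_pos.mpr (h1 k)) hstep k, Real.le_sqrt_of_sq_le ?_⟩
  have hconv := hsc (x k) xstar
  rw [norm_sub_rev] at hconv
  rw [div_mul_eq_mul_div, le_div_iff₀ hμ]
  linarith [h4 k]
end

section
/- Let f : ℝ^n → ℝ be differentiable and strongly convex with parameter μ > 0, let x* ∈ ℝ^n, and let y ∈ ℝ^n satisfy f(y) ≤ f(x*). Then ‖y − x* + (1/μ)·f′(x*)‖ ≤ (1/μ)·‖f′(x*)‖. -/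
open scoped RealInnerProductSpace

/-- Lemma 5.4: if `f` is differentiable and strongly convex with parameter `μ` and
`f y ≤ f x*`, then `y` lies in the ball `‖y − x* + (1/μ) f′(x*)‖ ≤ (1/μ)‖f′(x*)‖`. -/
theorem estimate_sublevel_in_ball {n : ℕ}
    (f : EuclideanSpace ℝ (Fin n) → ℝ)
    (f' : EuclideanSpace ℝ (Fin n) → EuclideanSpace ℝ (Fin n))
    (μ : ℝ) (hμ : 0 < μ)
    (hgrad : ∀ x, HasGradientAt f (f' x) x)
    (hsc : ∀ x y : EuclideanSpace ℝ (Fin n),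
      f y ≥ f x + ⟪f' x, y - x⟫ + μ / 2 * ‖x - y‖ ^ 2)
    (xstar y : EuclideanSpace ℝ (Fin n)) (hy : f y ≤ f xstar) :
    ‖y - xstar + (1 / μ) • f' xstar‖ ≤ 1 / μ * ‖f' xstar‖ := by
  have h := hsc xstar y
  rw [norm_sub_rev xstar y, real_inner_comm] at h
  have hscaled : 2 / μ * (⟪y - xstar, f' xstar⟫ + μ / 2 * ‖y - xstar‖ ^ 2) ≤ 0 :=
    mul_nonpos_of_nonneg_of_nonpos (by positivity) (by linarith)
  have hexpand : 2 / μ * (⟪y - xstar, f' xstar⟫ + μ / 2 * ‖y - xstar‖ ^ 2) =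
      ‖y - xstar‖ ^ 2 + 2 * (1 / μ * ⟪y - xstar, f' xstar⟫) := by
    field_simp
    ring
  have hsmul : ‖(1 / μ) • f' xstar‖ = 1 / μ * ‖f' xstar‖ :=
    norm_smul_of_nonneg (by positivity) _
  refine (sq_le_sq₀ (norm_nonneg _) (by positivity)).1 ?_
  rw [norm_add_sq_real, real_inner_smul_right, hsmul]
  linarith
end

section
/- Let f : ℝ^n → ℝ be differentiable and strongly convex with parameter μ > 0, let x* ∈ ℝ^n with f′(x*) ≠ 0, and define the halfspace H* = {x : ⟨f′(x*), x − x*⟩ ≥ 0}. Then for every y ∈ ℝ^n with f(y) ≤ f(x*), one has ‖y − x*‖ ≤ √( (2/μ)·‖f′(x*)‖·d(y, H*) ). -/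
open Metric
open scoped RealInnerProductSpace

/-- The signed violation of a halfspace constraint is at most the norm of the normal vector times
the distance to the halfspace. -/
theorem neg_inner_le_norm_mul_infDist_halfspace {E : Type*} [NormedAddCommGroup E]
    [InnerProductSpace ℝ E] {g : E} (hg : g ≠ 0) (a y : E) :
    -⟪g, y - a⟫ ≤ ‖g‖ * infDist y {x : E | 0 ≤ ⟪g, x - a⟫} := by
  have hg' : 0 < ‖g‖ := norm_pos_iff.mpr hg
  rw [← div_le_iff₀' hg']
  refine (le_infDist ⟨a, by simp⟩).mpr fun {h} hh => ?_
  rw [div_le_iff₀' hg', dist_eq_norm]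
  have hsplit : ⟪g, y - a⟫ = ⟪g, y - h⟫ + ⟪g, h - a⟫ := by
    rw [← inner_add_right, sub_add_sub_cancel]
  have hcs := neg_le_of_abs_le (abs_real_inner_le_norm g (y - h))
  have hh' : 0 ≤ ⟪g, h - a⟫ := hh
  linarith

/-- Theorem 6.3(2): for differentiable strongly convex `f` with parameter `μ`,
`f′(x*) ≠ 0` and `H* = {x : ⟪f′(x*), x − x*⟫ ≥ 0}`, every `y` with `f y ≤ f x*`
satisfies `‖y − x*‖ ≤ √((2/μ) ‖f′(x*)‖ d(y, H*))`. -/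
theorem norm_sub_le_sqrt_dist_to_halfspace {n : ℕ}
    (f : EuclideanSpace ℝ (Fin n) → ℝ)
    (f' : EuclideanSpace ℝ (Fin n) → EuclideanSpace ℝ (Fin n))
    (μ : ℝ) (hμ : 0 < μ)
    (hgrad : ∀ x, HasGradientAt f (f' x) x)
    (hsc : ∀ x y : EuclideanSpace ℝ (Fin n),
      f y ≥ f x + ⟪f' x, y - x⟫ + μ / 2 * ‖x - y‖ ^ 2)
    (xstar : EuclideanSpace ℝ (Fin n)) (hne : f' xstar ≠ 0)
    (y : EuclideanSpace ℝ (Fin n)) (hy : f y ≤ f xstar) :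
    ‖y - xstar‖ ≤
      Real.sqrt (2 / μ * ‖f' xstar‖ *
        infDist y {x : EuclideanSpace ℝ (Fin n) | 0 ≤ ⟪f' xstar, x - xstar⟫}) := by
  apply Real.le_sqrt_of_sq_le
  have hdist := neg_inner_le_norm_mul_infDist_halfspace hne xstar y
  have hconv := hsc xstar y
  rw [norm_sub_rev xstar y] at hconv
  rw [mul_assoc, div_mul_eq_mul_div, le_div_iff₀ hμ]
  linarith
end

section
/- Let n ≥ 2, let p be a positive even integer, let ε > 0, set θ = ε^{−p}, and let 1 ≤ k ≤ n − 1. Then the minimum of ∑_{i=1}^n ((e₁ − x)_i)^p over all x ∈ ℝ^n satisfying ⟨e₁ + ε·e_{j+1}, x⟩ ≤ 0 for j = 1, ..., k equals kθ / (1 + (kθ)^{1/(p−1)})^{p−1}. -/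
open scoped RealInnerProductSpace BigOperators

/-- The graph of an even power lies above its tangent line at a positive point. -/
theorem Even.tangent_le_pow {q : ℕ} (hq : Even (q + 1)) {a : ℝ} (ha : 0 < a) (y : ℝ) :
    a ^ (q + 1) + (q + 1) * a ^ q * (y - a) ≤ y ^ (q + 1) := by
  have key : ∀ z : ℝ, 1 + ((q + 1 : ℕ) : ℝ) * (z - 1) ≤ z ^ (q + 1) := by
    intro z
    rcases le_or_gt (-1) z with hz | hz
    · exact one_add_mul_sub_le_pow hz _
    · have hpow : 0 ≤ z ^ (q + 1) := hq.pow_nonneg z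
      have hq0 : (0 : ℝ) ≤ q := q.cast_nonneg
      push_cast
      nlinarith
  have hscaled := mul_le_mul_of_nonneg_left (key (y / a)) (pow_nonneg ha.le (q + 1))
  rw [← mul_pow, mul_div_cancel₀ _ ha.ne'] at hscaled
  refine le_of_eq_of_le ?_ hscaled
  push_cast
  have hy : a * (y / a) = y := mul_div_cancel₀ _ ha.ne'
  linear_combination -((q + 1) * a ^ q) * hy

theorem Fin.sum_ite_val_lt_const {m k : ℕ} (hk : k ≤ m) (C : ℝ) :
    ∑ i : Fin m, (if (i : ℕ) < k then C else 0) = k * C := by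
  rw [← Finset.sum_filter, Finset.sum_const, Fin.card_filter_val_lt, min_eq_right hk,
    nsmul_eq_mul]

/-- Proposition 6.2: for `p` a positive even integer, `θ = ε^{−p}`, and `1 ≤ k ≤ n−1`,
the minimum of `∑_i ((e₁ − x)_i)^p` over `{x : ⟪e₁ + ε e_{j+1}, x⟫ ≤ 0, j = 1, …, k}`
equals `kθ / (1 + (kθ)^{1/(p−1)})^{p−1}`. -/
theorem min_value_lower_bound_model (n : ℕ) (hn : 2 ≤ n)
    (p : ℕ) (hp : 0 < p) (hpe : Even p)
    (ε : ℝ) (hε : 0 < ε) (θ : ℝ) (hθ : θ = ε ^ (-(p : ℝ)))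
    (k : ℕ) (hk1 : 1 ≤ k) (hkn : k ≤ n - 1) :
    IsLeast
      ((fun x : EuclideanSpace ℝ (Fin n) =>
          ∑ i : Fin n,
            ((EuclideanSpace.single (⟨0, by omega⟩ : Fin n) (1 : ℝ)) i - x i) ^ p) ''
        {x : EuclideanSpace ℝ (Fin n) | ∀ j : Fin n, 1 ≤ (j : ℕ) → (j : ℕ) ≤ k →
          ⟪EuclideanSpace.single (⟨0, by omega⟩ : Fin n) (1 : ℝ) +
            ε • EuclideanSpace.single j (1 : ℝ), x⟫ ≤ 0})
      ((k : ℝ) * θ /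
        (1 + ((k : ℝ) * θ) ^ ((1 : ℝ) / ((p : ℝ) - 1))) ^ ((p : ℝ) - 1)) := by
  obtain ⟨m, rfl⟩ : ∃ m, n = m + 1 := ⟨n - 1, by omega⟩
  obtain ⟨q, rfl⟩ : ∃ q, p = q + 1 := ⟨p - 1, by omega⟩
  have hkm : k ≤ m := by omega
  have hq : q ≠ 0 := by
    rintro rfl
    simp at hpe
  have hk0 : (0 : ℝ) < k := by exact_mod_cast hk1
  have hθε : θ * ε ^ (q + 1) = 1 := by
    rw [hθ, Real.rpow_neg hε.le, Real.rpow_natCast]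
    exact inv_mul_cancel₀ (pow_pos hε _).ne'
  have hθ0 : 0 < θ := hθ ▸ Real.rpow_pos_of_pos hε _
  have hcast : ((q + 1 : ℕ) : ℝ) - 1 = q := by push_cast; ring
  rw [hcast, Real.rpow_natCast, one_div]
  have hcq : (((k : ℝ) * θ) ^ ((q : ℝ)⁻¹)) ^ q = k * θ :=
    Real.rpow_inv_natCast_pow (by positivity) hq
  have hc : 0 < ((k : ℝ) * θ) ^ ((q : ℝ)⁻¹) := Real.rpow_pos_of_pos (by positivity) _
  generalize ((k : ℝ) * θ) ^ ((q : ℝ)⁻¹) = c at hcq hc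
  -- `s` and `-s / ε` are the nonzero coordinates of the minimizer.
  obtain ⟨s, hs⟩ : ∃ s : ℝ, s = 1 / (1 + c) := ⟨_, rfl⟩
  have hs0 : 0 < s := by rw [hs]; positivity
  have hcs : c * s = 1 - s := by rw [hs]; field_simp; ring
  have hbalance : (1 - s) ^ q = k * (s / ε) ^ q / ε := by
    rw [← hcs, mul_pow, hcq, div_pow]
    rw [pow_succ] at hθε
    field_simp
    linear_combination hθε
  have hvalue : (k : ℝ) * θ / (1 + c) ^ q = (1 - s) ^ (q + 1) + k * (s / ε) ^ (q + 1) := by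
    have hleft : (k : ℝ) * θ / (1 + c) ^ q = (1 - s) ^ q := by
      rw [← hcs, mul_pow, hcq, hs, div_pow, one_pow]
      ring
    rw [hleft, pow_succ (1 - s), pow_succ (s / ε)]
    linear_combination s * hbalance
  rw [hvalue]
  have hzero : (⟨0, by omega⟩ : Fin (m + 1)) = 0 := rfl
  simp only [hzero, Fin.sum_univ_succ, inner_add_left, real_inner_smul_left,
    EuclideanSpace.inner_single_left, map_one, one_mul]
  constructor
  · refine ⟨WithLp.toLp 2 (Fin.cons s fun i : Fin m => if (i : ℕ) < k then -(s / ε) else 0),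
      ?_, ?_⟩
    · intro j hj1 hjk
      obtain ⟨i, rfl⟩ := Fin.exists_succ_eq.mpr (show j ≠ 0 by rintro rfl; simp at hj1)
      have hik : (i : ℕ) < k := by simpa using hjk
      simp only [Fin.cons_zero, Fin.cons_succ, if_pos hik]
      field_simp
      simp
    · rw [← Fin.sum_ite_val_lt_const hkm]
      simp only [Fin.cons_zero, Fin.cons_succ]
      congr 1
      simp only [PiLp.single_apply, Fin.succ_ne_zero, if_false]
      refine Finset.sum_congr rfl fun i _ => ?_
      split_ifs <;> simp
  · rintro _ ⟨x, hx, rfl⟩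
    have hfirst := hpe.tangent_le_pow (a := 1 - s) (hcs ▸ mul_pos hc hs0) (1 - x 0)
    have hb : 0 < s / ε := by positivity
    have hrest : (k : ℝ) * ((s / ε) ^ (q + 1) + (q + 1) * (s / ε) ^ q * (x 0 / ε - s / ε)) ≤
        ∑ i : Fin m, (0 - x i.succ) ^ (q + 1) := by
      rw [← Fin.sum_ite_val_lt_const hkm]
      refine Finset.sum_le_sum fun i _ => ?_
      split_ifs with hi
      · refine le_trans ?_ (hpe.tangent_le_pow hb (0 - x i.succ))
        have hconstr := hx i.succ (by simp) (by simpa using hi)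
        have hxi : x 0 / ε ≤ 0 - x i.succ := by
          rw [div_le_iff₀ hε]
          linarith
        gcongr
      · exact hpe.pow_nonneg _
    have hslope : (q + 1) * (1 - s) ^ q * (1 - x 0 - (1 - s)) +
        k * ((q + 1) * (s / ε) ^ q * (x 0 / ε - s / ε)) = 0 := by
      rw [hbalance]
      ring
    simp only [PiLp.single_apply, if_true, Fin.succ_ne_zero, if_false]
    linarith
end

section
/- Let p ≥ 1 and γ > 0. Suppose {α_k}_{k≥1} is a strictly decreasing sequence of positive real numbers converging to zero such that α_{k+1} ≥ α_k·(1 − γ·α_k^p) for all k ≥ 1. Then there exists a constant M₂ ≥ 0 such that α_k ≥ 1 / (2pγ·(k + M₂))^{1/p} for all k ≥ 1. -/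
open Filter

/-- One step of the recursion raises the reciprocal `p`-th power by at most `2pγ`, once the
current term is small. -/
lemma inv_rpow_le_inv_rpow_add {p γ x y : ℝ} (hp : 1 ≤ p) (hγ : 0 < γ) (hx : 0 < x)
    (hsmall : p * γ * x ^ p ≤ 1 / 2) (hxy : x * (1 - γ * x ^ p) ≤ y) :
    (y ^ p)⁻¹ ≤ (x ^ p)⁻¹ + 2 * p * γ := by
  have ha : 0 < x ^ p := Real.rpow_pos_of_pos hx p
  have hγa : 0 < γ * x ^ p := mul_pos hγ ha
  have hγa_le : γ * x ^ p ≤ 1 / 2 := by nlinarith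
  have hbern : 1 - p * (γ * x ^ p) ≤ (1 - γ * x ^ p) ^ p := by
    have := one_add_mul_self_le_rpow_one_add (s := -(γ * x ^ p)) (by linarith) hp
    simpa [sub_eq_add_neg] using this
  have hpow : x ^ p * (1 - γ * x ^ p) ^ p ≤ y ^ p := by
    rw [← Real.mul_rpow hx.le (by linarith)]
    exact Real.rpow_le_rpow (mul_nonneg hx.le (by linarith)) hxy (by linarith)
  have hlow : x ^ p * (1 - p * (γ * x ^ p)) ≤ y ^ p :=
    (mul_le_mul_of_nonneg_left hbern ha.le).trans hpow
  have hlow_pos : 0 < x ^ p * (1 - p * (γ * x ^ p)) := mul_pos ha (by linarith)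
  refine (inv_anti₀ hlow_pos hlow).trans ?_
  have hu : 0 < p * γ * x ^ p := by positivity
  rw [inv_le_iff_one_le_mul₀ hlow_pos]
  have hexpand : ((x ^ p)⁻¹ + 2 * p * γ) * (x ^ p * (1 - p * (γ * x ^ p))) =
      (1 + 2 * (p * γ * x ^ p)) * (1 - p * γ * x ^ p) := by
    field_simp
  rw [hexpand]
  nlinarith

/-- Lemma 7.1: lower bound on the convergence of a sequence. If `{α_k}` is a strictly
decreasing positive sequence converging to zero with
`α_{k+1} ≥ α_k (1 − γ α_k^p)`, then there is `M₂ ≥ 0` with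
`α_k ≥ 1/(2pγ(k + M₂))^{1/p}` for all `k ≥ 1`. -/
theorem lower_bound_on_sequence_rate
    (p γ : ℝ) (hp : 1 ≤ p) (hγ : 0 < γ)
    (α : ℕ → ℝ)
    (hpos : ∀ k : ℕ, 1 ≤ k → 0 < α k)
    (hanti : ∀ k : ℕ, 1 ≤ k → α (k + 1) < α k)
    (hlim : Tendsto α atTop (nhds 0))
    (hrec : ∀ k : ℕ, 1 ≤ k → α (k + 1) ≥ α k * (1 - γ * α k ^ p)) :
    ∃ M₂ : ℝ, 0 ≤ M₂ ∧ ∀ k : ℕ, 1 ≤ k →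
      α k ≥ 1 / (2 * p * γ * ((k : ℝ) + M₂)) ^ ((1 : ℝ) / p) := by
  have hp0 : 0 < p := by linarith
  have hsmall : ∀ᶠ k in atTop, p * γ * α k ^ p ≤ 1 / 2 := by
    have h : Tendsto (fun k => p * γ * α k ^ p) atTop (nhds 0) := by
      simpa [Real.zero_rpow hp0.ne'] using
        (hlim.rpow_const (p := p) (Or.inr hp0.le)).const_mul (p * γ)
    exact h.eventually_le_const (by norm_num)
  obtain ⟨K, hK⟩ := eventually_atTop.1 (hsmall.and (eventually_ge_atTop 1))
  have hK1 : 1 ≤ K := (hK K le_rfl).2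
  have hb : 0 < (α K ^ p)⁻¹ := inv_pos.2 (Real.rpow_pos_of_pos (hpos K hK1) p)
  have hanti' : AntitoneOn α (Set.Ici 1) :=
    antitoneOn_of_succ_le Set.ordConnected_Ici fun k _ hk _ => (hanti k hk).le
  have hbound : ∀ k : ℕ, 1 ≤ k → (α k ^ p)⁻¹ ≤ (α K ^ p)⁻¹ + 2 * p * γ * k := by
    intro k hk
    rcases le_total k K with hkK | hKk
    · have h : (α k ^ p)⁻¹ ≤ (α K ^ p)⁻¹ :=
        inv_anti₀ (Real.rpow_pos_of_pos (hpos K hK1) p)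
          (Real.rpow_le_rpow (hpos K hK1).le (hanti' hk hK1 hkK) hp0.le)
      have : 0 ≤ 2 * p * γ * k := by positivity
      linarith
    · clear hk
      induction k, hKk using Nat.le_induction with
      | base =>
        have : 0 ≤ 2 * p * γ * K := by positivity
        linarith
      | succ n hn ih =>
        obtain ⟨hns, hn1⟩ := hK n hn
        have := inv_rpow_le_inv_rpow_add hp hγ (hpos n hn1) hns (hrec n hn1)
        push_cast
        linarith
  refine ⟨(α K ^ p)⁻¹ / (2 * p * γ), by positivity, fun k hk => ?_⟩
  have heq : 2 * p * γ * ((k : ℝ) + (α K ^ p)⁻¹ / (2 * p * γ)) =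
      (α K ^ p)⁻¹ + 2 * p * γ * k := by
    field_simp
    ring
  have hαk := hpos k hk
  have hroot : (α k)⁻¹ ≤ ((α K ^ p)⁻¹ + 2 * p * γ * k) ^ (1 / p) := by
    rw [one_div, Real.le_rpow_inv_iff_of_pos (by positivity) (by positivity) hp0,
      Real.inv_rpow hαk.le]
    exact hbound k hk
  rw [heq, ge_iff_le, one_div]
  exact inv_le_of_inv_le₀ hαk hroot
end

section
/- Let p ≥ 1, let x₀ = (1, 0) ∈ ℝ², let 0 < u < 1, let x = (u, u^p) ∈ ℝ², and suppose λ ∈ ℝ is such that the point y = λ·(u, −u^p) satisfies ⟨x − x₀, x − y⟩ = 0. Then λ·(1 − u + u^{2p−1}) = 1 − u − u^{2p−1}; in particular, λ·u = u·(1 − 2u^{2p−1}/(1 − u + u^{2p−1})). Consequently, if the next Haugazeau iterate x_{k+1} has first coordinate u_{k+1} ≥ λ·u (as holds for the sets C_± = {(u, v) : ±v ≥ |u|^p}), then u_{k+1} ≥ u_k·(1 − 2u_k^{2p−1}/(1 − u_k + u_k^{2p−1})). -/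
open scoped RealInnerProductSpace

/-- Proposition 6.5 (key computation): for `p ≥ 1`, `0 < u < 1`, `x₀ = (1, 0)`,
`x = (u, u^p)`, and `y = λ (u, −u^p)` with `⟪x − x₀, x − y⟫ = 0`, one has
`λ (1 − u + u^{2p−1}) = 1 − u − u^{2p−1}` and hence
`λ u = u (1 − 2 u^{2p−1}/(1 − u + u^{2p−1}))`; consequently any `u′ ≥ λ u`
satisfies `u′ ≥ u (1 − 2 u^{2p−1}/(1 − u + u^{2p−1}))`. -/
theorem haugazeau_no_linear_metric_recurrence
    (p : ℝ) (hp : 1 ≤ p) (u lam : ℝ) (hu0 : 0 < u) (hu1 : u < 1)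
    (x₀ x y : EuclideanSpace ℝ (Fin 2))
    (hx₀0 : x₀ 0 = 1) (hx₀1 : x₀ 1 = 0)
    (hx0 : x 0 = u) (hx1 : x 1 = u ^ p)
    (hy0 : y 0 = lam * u) (hy1 : y 1 = lam * (-(u ^ p)))
    (hperp : ⟪x - x₀, x - y⟫ = 0) :
    lam * (1 - u + u ^ (2 * p - 1)) = 1 - u - u ^ (2 * p - 1) ∧
    lam * u = u * (1 - 2 * u ^ (2 * p - 1) / (1 - u + u ^ (2 * p - 1))) ∧
    ∀ u' : ℝ, lam * u ≤ u' →
      u * (1 - 2 * u ^ (2 * p - 1) / (1 - u + u ^ (2 * p - 1))) ≤ u' := by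
  have hw : 0 < u ^ (2 * p - 1) := Real.rpow_pos_of_pos hu0 _
  have hpow : u ^ p * u ^ p = u * u ^ (2 * p - 1) := by
    rw [← Real.rpow_add hu0, ← Real.rpow_one_add' hu0.le (by linarith)]
    ring_nf
  simp only [PiLp.inner_apply, Fin.sum_univ_two, PiLp.sub_apply, hx₀0, hx₀1, hx0, hx1, hy0, hy1,
    RCLike.inner_apply, conj_trivial] at hperp
  generalize u ^ (2 * p - 1) = w at *
  have hlam : lam * (1 - u + w) = 1 - u - w := by
    apply mul_left_cancel₀ hu0.ne'
    linear_combination hperp - (1 + lam) * hpow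
  have hden : 0 < 1 - u + w := by linarith
  have heq : lam * u = u * (1 - 2 * w / (1 - u + w)) := by
    field_simp
    linear_combination hlam
  exact ⟨hlam, heq, fun _ h => heq ▸ h⟩
end
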